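/- arXiv:1712.10217 — 11 statements merged into one kernel-verified Lean document; each statement's English description precedes it below -/
import Mathlib

section
/- Let 𝓛, ℋ : ℝⁿ × ℝⁿ → ℝ be mutual Legendre transforms in the second variable, i.e. ℋ(z,ξ) = sup_{v∈ℝⁿ}(⟨v,ξ⟩ − 𝓛(z,v)) and 𝓛(z,v) = sup_{ξ∈ℝⁿ}(⟨v,ξ⟩ − ℋ(z,ξ)) for all z, v, ξ, with all suprema finite, and let V : ℝⁿ → ℝⁿ be a co-vector field. Then the following are equivalent: (a) 𝓛(z,v) − 𝓛(z,−v) = ⟨V(z), v⟩ for all z, v ∈ ℝⁿ; (b) ℋ(z,ξ) = ℋ(z, V(z) − ξ) for all z, ξ ∈ ℝⁿ. -/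
open scoped RealInnerProductSpace

/-- Proposition 3.1: equivalence between the fluctuation symmetry of the Lagrangian
and symmetry of the Hamiltonian around `½ V`. -/
theorem fluctuation_symmetry_iff_hamiltonian_symmetry (n : ℕ)
    (L H : EuclideanSpace ℝ (Fin n) → EuclideanSpace ℝ (Fin n) → ℝ)
    (V : EuclideanSpace ℝ (Fin n) → EuclideanSpace ℝ (Fin n))
    (hH : ∀ z ξ, IsLUB {y : ℝ | ∃ v, y = ⟪v, ξ⟫ - L z v} (H z ξ))
    (hL : ∀ z v, IsLUB {y : ℝ | ∃ ξ, y = ⟪v, ξ⟫ - H z ξ} (L z v)) :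
    (∀ z v, L z v - L z (-v) = ⟪V z, v⟫) ↔
      (∀ z ξ, H z ξ = H z (V z - ξ)) := by
  constructor
  · intro h
    have key : ∀ z ξ, H z ξ ≤ H z (V z - ξ) := by
      intro z ξ
      refine (hH z ξ).2 ?_
      rintro _ ⟨v, rfl⟩
      have h₁ : ⟪-v, V z - ξ⟫ - L z (-v) ≤ H z (V z - ξ) := (hH z (V z - ξ)).1 ⟨-v, rfl⟩
      have h₂ := h z v
      rw [inner_neg_left, inner_sub_right, real_inner_comm] at h₁
      linarith
    intro z ξ
    refine le_antisymm (key z ξ) ?_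
    simpa using key z (V z - ξ)
  · intro h
    have key : ∀ z v, L z v ≤ L z (-v) + ⟪V z, v⟫ := by
      intro z v
      refine (hL z v).2 ?_
      rintro _ ⟨ξ, rfl⟩
      have h₁ : ⟪-v, V z - ξ⟫ - H z (V z - ξ) ≤ L z (-v) := (hL z (-v)).1 ⟨V z - ξ, rfl⟩
      rw [inner_neg_left, inner_sub_right, real_inner_comm, ← h z ξ] at h₁
      linarith
    intro z v
    have h₁ := key z v
    have h₂ := key z (-v)
    rw [neg_neg, inner_neg_right] at h₂
    linarith
end

section
/- Let S : ℝⁿ → ℝ be differentiable with gradient ∇S, and let ℋ : ℝⁿ × ℝⁿ → ℝ satisfy ℋ(z,0) = 0 for all z and be reversible with respect to S, i.e. ℋ(z,ξ) = ℋ(z, ∇S(z) − ξ) for all z, ξ. Assume the Legendre transform 𝓛(z,v) = sup_{ξ∈ℝⁿ}(⟨v,ξ⟩ − ℋ(z,ξ)) is finite for all z, v. If F : ℝⁿ → ℝⁿ satisfies 𝓛(z, F(z)) = 0 for all z (F is a zero-cost flow field), then ⟨∇S(z), F(z)⟩ ≤ 0 for every z ∈ ℝⁿ; consequently, for every differentiable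 curve z : [0,T] → ℝⁿ with z'(t) = F(z(t)) for all t, the function t ↦ S(z(t)) is nonincreasing. -/
open scoped RealInnerProductSpace

/-- Proposition 3.2: `S` is a Lyapunov function for the zero-cost flow of a Hamiltonian
that is reversible with respect to `S`. -/
theorem entropy_lyapunov_of_reversible_hamiltonian (n : ℕ)
    (S : EuclideanSpace ℝ (Fin n) → ℝ)
    (gradS : EuclideanSpace ℝ (Fin n) → EuclideanSpace ℝ (Fin n))
    (hS : ∀ z, HasGradientAt S (gradS z) z)
    (H : EuclideanSpace ℝ (Fin n) → EuclideanSpace ℝ (Fin n) → ℝ)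
    (hH0 : ∀ z, H z 0 = 0)
    (hrev : ∀ z ξ, H z ξ = H z (gradS z - ξ))
    (L : EuclideanSpace ℝ (Fin n) → EuclideanSpace ℝ (Fin n) → ℝ)
    (hL : ∀ z v, IsLUB {y : ℝ | ∃ ξ, y = ⟪v, ξ⟫ - H z ξ} (L z v))
    (F : EuclideanSpace ℝ (Fin n) → EuclideanSpace ℝ (Fin n))
    (hF : ∀ z, L z (F z) = 0) :
    (∀ z, ⟪gradS z, F z⟫ ≤ 0) ∧
      ∀ (T : ℝ) (zc : ℝ → EuclideanSpace ℝ (Fin n)),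
        (∀ t ∈ Set.Icc (0 : ℝ) T, HasDerivAt zc (F (zc t)) t) →
        AntitoneOn (fun t => S (zc t)) (Set.Icc (0 : ℝ) T) := by
  have hdecr : ∀ z, ⟪gradS z, F z⟫ ≤ 0 := by
    intro z
    have hH : H z (gradS z) = 0 := by rw [hrev, sub_self, hH0]
    have hle := (hL z (F z)).1 ⟨gradS z, rfl⟩
    rwa [hF, hH, sub_zero, real_inner_comm] at hle
  refine ⟨hdecr, fun T zc hzc => ?_⟩
  have hderiv : ∀ t ∈ Set.Icc (0 : ℝ) T,
      HasDerivAt (fun t => S (zc t)) ⟪gradS (zc t), F (zc t)⟫ t := by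
    intro t ht
    exact (hS (zc t)).hasFDerivAt.comp_hasDerivAt t (hzc t ht)
  exact antitoneOn_of_hasDerivWithinAt_nonpos (convex_Icc 0 T)
    (fun t ht => (hderiv t ht).continuousAt.continuousWithinAt)
    (fun t ht => (hderiv t (interior_subset ht)).hasDerivWithinAt)
    (fun t _ => hdecr (zc t))
end

section
/- Let S : ℝⁿ → ℝ be differentiable with gradient ∇S, let ℋ : ℝⁿ × ℝⁿ → ℝ satisfy ℋ(z,0) = 0 for all z, and define Ψ*(z,ξ) := ℋ(z, ξ + ½∇S(z)) − ℋ(z, ½∇S(z)). Let 𝓛 and Ψ be the second-variable Legendre transforms of ℋ and Ψ* respectively, assumed finite everywhere. Then for all z, v ∈ ℝⁿ: 𝓛(z,v) = Ψ(z,v) + Ψ*(z, −½∇S(z)) + ½⟨v, ∇S(z)⟩. -/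
open scoped RealInnerProductSpace

/-- The central identity in Theorem 3.3: recentering the Hamiltonian around `½∇S`
expresses the Lagrangian via the dissipation potentials. -/
theorem lagrangian_eq_dissipation_decomposition (n : ℕ)
    (S : EuclideanSpace ℝ (Fin n) → ℝ)
    (gradS : EuclideanSpace ℝ (Fin n) → EuclideanSpace ℝ (Fin n))
    (hS : ∀ z, HasGradientAt S (gradS z) z)
    (H : EuclideanSpace ℝ (Fin n) → EuclideanSpace ℝ (Fin n) → ℝ)
    (hH0 : ∀ z, H z 0 = 0)
    (Ψstar : EuclideanSpace ℝ (Fin n) → EuclideanSpace ℝ (Fin n) → ℝ)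
    (hΨstar : ∀ z ξ, Ψstar z ξ =
      H z (ξ + (2⁻¹ : ℝ) • gradS z) - H z ((2⁻¹ : ℝ) • gradS z))
    (L Ψ : EuclideanSpace ℝ (Fin n) → EuclideanSpace ℝ (Fin n) → ℝ)
    (hL : ∀ z v, IsLUB {y : ℝ | ∃ ξ, y = ⟪v, ξ⟫ - H z ξ} (L z v))
    (hΨ : ∀ z v, IsLUB {y : ℝ | ∃ ξ, y = ⟪v, ξ⟫ - Ψstar z ξ} (Ψ z v)) :
    ∀ z v, L z v = Ψ z v + Ψstar z (-(2⁻¹ : ℝ) • gradS z) + (2⁻¹ : ℝ) * ⟪v, gradS z⟫ := by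
  intro z v
  have hshift : Ψstar z (-(2⁻¹ : ℝ) • gradS z) = -H z ((2⁻¹ : ℝ) • gradS z) := by
    rw [hΨstar, neg_smul, neg_add_cancel, hH0, zero_sub]
  rw [hshift]
  apply le_antisymm
  · refine (hL z v).2 ?_
    rintro _ ⟨ξ, rfl⟩
    have h := (hΨ z v).1 ⟨ξ - (2⁻¹ : ℝ) • gradS z, rfl⟩
    rw [hΨstar, sub_add_cancel, inner_sub_right, real_inner_smul_right] at h
    linarith
  · suffices h : Ψ z v ≤ L z v + H z ((2⁻¹ : ℝ) • gradS z) - 2⁻¹ * ⟪v, gradS z⟫ by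
      linarith
    refine (hΨ z v).2 ?_
    rintro _ ⟨ξ, rfl⟩
    have h := (hL z v).1 ⟨ξ + (2⁻¹ : ℝ) • gradS z, rfl⟩
    rw [inner_add_right, real_inner_smul_right] at h
    rw [hΨstar]
    linarith
end

section
/- Let S : ℝⁿ → ℝ be differentiable with gradient ∇S, let ℋ : ℝⁿ × ℝⁿ → ℝ satisfy ℋ(z,0) = 0 and be convex in its second variable, define Ψ*(z,ξ) := ℋ(z, ξ + ½∇S(z)) − ℋ(z, ½∇S(z)), let 𝓛 and Ψ be the second-variable Legendre transforms of ℋ and Ψ* respectively (assumed finite everywhere), and let F : ℝⁿ → ℝⁿ be a vector field. Then the following are equivalent: (a) ℋ is reversible with respect to S, i.e. ℋ(z,ξ) = ℋ(z, ∇S(z) − ξ) for all z, ξ, and F is the zero-cost flow for 𝓛, i.e. 𝓛(z, F(z)) = 0 for all z; (b) Ψ* is symmetric, i.e. Ψ*(z,ξ) = Ψ*(z,−ξ) for all z, ξ, and F is the gradient flow of S with respect to (Ψ, Ψ*), i.e. Ψ(z, F(z)) + Ψ*(z, −½∇S(z)) + ½⟨F(z), ∇S(z)⟩ = 0 for all z.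 -/
open scoped RealInnerProductSpace

/-- Translating a function by `a` and subtracting the constant `c` changes its Legendre transform
at `v` by `c - ⟪v, a⟫`. -/
theorem IsLUB.legendre_translate {E : Type*} [NormedAddCommGroup E] [InnerProductSpace ℝ E]
    {h : E → ℝ} {v : E} {l : ℝ} (hl : IsLUB {y : ℝ | ∃ ξ, y = ⟪v, ξ⟫ - h ξ} l) (a : E) (c : ℝ) :
    IsLUB {y : ℝ | ∃ ξ, y = ⟪v, ξ⟫ - (h (ξ + a) - c)} (l - ⟪v, a⟫ + c) := by
  constructor
  · rintro _ ⟨ξ, rfl⟩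
    have := hl.1 ⟨ξ + a, rfl⟩
    rw [inner_add_right] at this
    linarith
  · intro b hb
    have : l ≤ b + ⟪v, a⟫ - c := by
      refine hl.2 ?_
      rintro _ ⟨ξ, rfl⟩
      have := hb ⟨ξ - a, rfl⟩
      rw [inner_sub_right, sub_add_cancel] at this
      linarith
    linarith

/-- A function is invariant under the reflection `ξ ↦ g - ξ` iff its translate by `g / 2`,
normalized by a constant, is even. -/
theorem reflection_invariant_iff_translate_even {E : Type*} [AddCommGroup E] [Module ℝ E]
    (h : E → ℝ) (g : E) (c : ℝ) :
    (∀ ξ, h ξ = h (g - ξ)) ↔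
      ∀ ξ, h (ξ + (2⁻¹ : ℝ) • g) - c = h (-ξ + (2⁻¹ : ℝ) • g) - c := by
  constructor
  · intro H ξ
    rw [H (ξ + (2⁻¹ : ℝ) • g)]
    congr 2
    module
  · intro H ξ
    have := H (ξ - (2⁻¹ : ℝ) • g)
    rw [sub_add_cancel, sub_left_inj] at this
    rw [this]
    congr 1
    module

/-- Theorem 3.3 (Theorem 2.1 of Mielke–Peletier–Renger): a Hamiltonian is reversible with
respect to `S` and `F` is its zero-cost flow iff `Ψ*` is symmetric and `F` is the gradient
flow of `S` with respect to `(Ψ, Ψ*)`. -/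
theorem reversible_hamiltonian_iff_gradient_flow (n : ℕ)
    (S : EuclideanSpace ℝ (Fin n) → ℝ)
    (gradS : EuclideanSpace ℝ (Fin n) → EuclideanSpace ℝ (Fin n))
    (hS : ∀ z, HasGradientAt S (gradS z) z)
    (H : EuclideanSpace ℝ (Fin n) → EuclideanSpace ℝ (Fin n) → ℝ)
    (hH0 : ∀ z, H z 0 = 0)
    (hHconv : ∀ z, ConvexOn ℝ Set.univ (H z))
    (Ψstar : EuclideanSpace ℝ (Fin n) → EuclideanSpace ℝ (Fin n) → ℝ)
    (hΨstar : ∀ z ξ, Ψstar z ξ =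
      H z (ξ + (2⁻¹ : ℝ) • gradS z) - H z ((2⁻¹ : ℝ) • gradS z))
    (L Ψ : EuclideanSpace ℝ (Fin n) → EuclideanSpace ℝ (Fin n) → ℝ)
    (hL : ∀ z v, IsLUB {y : ℝ | ∃ ξ, y = ⟪v, ξ⟫ - H z ξ} (L z v))
    (hΨ : ∀ z v, IsLUB {y : ℝ | ∃ ξ, y = ⟪v, ξ⟫ - Ψstar z ξ} (Ψ z v))
    (F : EuclideanSpace ℝ (Fin n) → EuclideanSpace ℝ (Fin n)) :
    ((∀ z ξ, H z ξ = H z (gradS z - ξ)) ∧ (∀ z, L z (F z) = 0)) ↔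
      ((∀ z ξ, Ψstar z ξ = Ψstar z (-ξ)) ∧
        (∀ z, Ψ z (F z) + Ψstar z (-(2⁻¹ : ℝ) • gradS z)
          + (2⁻¹ : ℝ) * ⟪F z, gradS z⟫ = 0)) := by
  have sum_eq (z) : Ψ z (F z) + Ψstar z (-(2⁻¹ : ℝ) • gradS z)
      + (2⁻¹ : ℝ) * ⟪F z, gradS z⟫ = L z (F z) := by
    have hΨz := hΨ z (F z)
    simp only [hΨstar] at hΨz
    rw [hΨz.unique ((hL z (F z)).legendre_translate _ _), hΨstar, neg_smul, neg_add_cancel, hH0,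
      real_inner_smul_right]
    ring
  simp only [sum_eq]
  simp only [hΨstar]
  exact and_congr_left' (forall_congr' fun z =>
    reflection_invariant_iff_translate_even (H z) (gradS z) _)
end

section
/- Let W, V : ℝⁿ → ℝⁿ be vector fields and let ℋ₂, 𝓛₂ : ℝⁿ × ℝⁿ → ℝ be mutual second-variable Legendre transforms (ℋ₂(z,ξ) = sup_v(⟨v,ξ⟩ − 𝓛₂(z,v)) and 𝓛₂(z,v) = sup_ξ(⟨v,ξ⟩ − ℋ₂(z,ξ)), all suprema finite). Define ℋ(z,ξ) := ⟨W(z), ξ⟩ + ℋ₂(z,ξ) and let 𝓛 be the second-variable Legendre transform of ℋ, assumed finite everywhere. Then the following are equivalent: (a) ℋ₂(z,ξ) = ℋ₂(z, V(z) − ξ) for all z, ξ (ℋ₂ is symmetric around ½V); (b) 𝓛(z, W(z) + v) − 𝓛(z, W(z) − v) = ⟨V(z), v⟩ for all z, v. -/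
open scoped RealInnerProductSpace

section LegendreTransform

variable {E : Type*} [NormedAddCommGroup E] [InnerProductSpace ℝ E]

/-- The Legendre transform of a function symmetric around `a / 2` satisfies the fluctuation
symmetry with respect to `a`. -/
theorem legendre_sub_neg_of_symmetric {f g : E → ℝ} {a : E}
    (hg : ∀ v, IsLUB {y : ℝ | ∃ ξ, y = ⟪v, ξ⟫ - f ξ} (g v))
    (hf : ∀ ξ, f ξ = f (a - ξ)) (v : E) : g v - g (-v) = ⟪a, v⟫ := by
  have key : ∀ w, g w ≤ ⟪a, w⟫ + g (-w) := by
    intro w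
    refine (hg w).2 ?_
    rintro _ ⟨ξ, rfl⟩
    have h := (hg (-w)).1 ⟨a - ξ, rfl⟩
    rw [← hf ξ, inner_neg_left, inner_sub_right, real_inner_comm] at h
    linarith
  have h := key (-v)
  rw [neg_neg, inner_neg_right] at h
  linarith [key v]

/-- The Legendre transform of a function with the fluctuation symmetry with respect to `a` is
symmetric around `a / 2`. -/
theorem legendre_symmetric_of_sub_neg {g h : E → ℝ} {a : E}
    (hh : ∀ ξ, IsLUB {y : ℝ | ∃ v, y = ⟪v, ξ⟫ - g v} (h ξ))
    (hg : ∀ v, g v - g (-v) = ⟪a, v⟫) (ξ : E) : h ξ = h (a - ξ) := by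
  have key : ∀ η, h η ≤ h (a - η) := by
    intro η
    refine (hh η).2 ?_
    rintro _ ⟨v, rfl⟩
    have h₁ := (hh (a - η)).1 ⟨-v, rfl⟩
    rw [inner_neg_left, inner_sub_right, real_inner_comm] at h₁
    linarith [hg v]
  refine le_antisymm (key ξ) ?_
  simpa using key (a - ξ)

/-- Adding the linear term `⟪w, ξ⟫` to a function translates its Legendre transform by `w`. -/
theorem legendre_add_linear {f k g l : E → ℝ} {w : E}
    (hg : ∀ v, IsLUB {y : ℝ | ∃ ξ, y = ⟪v, ξ⟫ - f ξ} (g v))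
    (hk : ∀ ξ, k ξ = ⟪w, ξ⟫ + f ξ)
    (hl : ∀ v, IsLUB {y : ℝ | ∃ ξ, y = ⟪v, ξ⟫ - k ξ} (l v)) (v : E) :
    l (w + v) = g v := by
  refine (hl (w + v)).unique ?_
  simpa only [hk, inner_add_left, add_sub_add_left_eq_sub] using hg v

end LegendreTransform

/-- Proposition 3.4: translating the fluctuation symmetry of the Lagrangian to the vector
field `W` is equivalent to adding the linear term `⟨W(z), ξ⟩` to the Hamiltonian. -/
theorem shifted_fluctuation_symmetry_iff_hamiltonian_decomposition (n : ℕ)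
    (W V : EuclideanSpace ℝ (Fin n) → EuclideanSpace ℝ (Fin n))
    (H₂ L₂ : EuclideanSpace ℝ (Fin n) → EuclideanSpace ℝ (Fin n) → ℝ)
    (hH₂ : ∀ z ξ, IsLUB {y : ℝ | ∃ v, y = ⟪v, ξ⟫ - L₂ z v} (H₂ z ξ))
    (hL₂ : ∀ z v, IsLUB {y : ℝ | ∃ ξ, y = ⟪v, ξ⟫ - H₂ z ξ} (L₂ z v))
    (H : EuclideanSpace ℝ (Fin n) → EuclideanSpace ℝ (Fin n) → ℝ)
    (hH : ∀ z ξ, H z ξ = ⟪W z, ξ⟫ + H₂ z ξ)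
    (L : EuclideanSpace ℝ (Fin n) → EuclideanSpace ℝ (Fin n) → ℝ)
    (hL : ∀ z v, IsLUB {y : ℝ | ∃ ξ, y = ⟪v, ξ⟫ - H z ξ} (L z v)) :
    (∀ z ξ, H₂ z ξ = H₂ z (V z - ξ)) ↔
      (∀ z v, L z (W z + v) - L z (W z - v) = ⟪V z, v⟫) := by
  have hLL : ∀ z v, L z (W z + v) = L₂ z v := fun z =>
    legendre_add_linear (hL₂ z) (hH z) (hL z)
  simp only [sub_eq_add_neg (W _), hLL]
  exact ⟨fun h z => legendre_sub_neg_of_symmetric (hL₂ z) (h z),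
    fun h z => legendre_symmetric_of_sub_neg (hH₂ z) (h z)⟩
end

section
/- Let S : ℝⁿ → ℝ be differentiable with gradient ∇S, let W, F : ℝⁿ → ℝⁿ be vector fields, and let 𝓛 : ℝⁿ × ℝⁿ → ℝ be nonnegative and satisfy the generalized fluctuation symmetry 𝓛(z, W(z) + v) − 𝓛(z, W(z) − v) = ⟨∇S(z), v⟩ for all z, v ∈ ℝⁿ. If 𝓛(z, F(z)) = 0 for all z, then ⟨∇S(z), F(z)⟩ ≤ ⟨∇S(z), W(z)⟩ for every z ∈ ℝⁿ. -/
open scoped RealInnerProductSpace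

/-- Display (3.8) of the paper: under the generalized fluctuation symmetry around `W`,
along the zero-cost flow one has `⟨∇S, F⟩ ≤ ⟨∇S, W⟩`. -/
theorem entropy_production_bound_of_shifted_fluctuation_symmetry (n : ℕ)
    (S : EuclideanSpace ℝ (Fin n) → ℝ)
    (gradS : EuclideanSpace ℝ (Fin n) → EuclideanSpace ℝ (Fin n))
    (hS : ∀ z, HasGradientAt S (gradS z) z)
    (W F : EuclideanSpace ℝ (Fin n) → EuclideanSpace ℝ (Fin n))
    (L : EuclideanSpace ℝ (Fin n) → EuclideanSpace ℝ (Fin n) → ℝ)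
    (hLnonneg : ∀ z v, 0 ≤ L z v)
    (hsym : ∀ z v, L z (W z + v) - L z (W z - v) = ⟪gradS z, v⟫)
    (hF : ∀ z, L z (F z) = 0) :
    ∀ z, ⟪gradS z, F z⟫ ≤ ⟪gradS z, W z⟫ := by
  intro z
  have h := hsym z (F z - W z)
  rw [add_sub_cancel, hF, inner_sub_right] at h
  linarith [hLnonneg z (W z - (F z - W z))]
end

section
/- Let W : ℝⁿ → ℝⁿ be continuously differentiable. For twice continuously differentiable functions F, G : ℝⁿ × ℝ → ℝ define the bracket {F, G}(z, e) := ∂_e G(z,e) · ⟨W(z), ∇_z F(z,e)⟩ − ∂_e F(z,e) · ⟨W(z), ∇_z G(z,e)⟩, where ∇_z denotes the gradient in the ℝⁿ-variable and ∂_e the partial derivative in the ℝ-variable. Then for all twice continuously differentiable F₁, F₂, F₃ : ℝⁿ × ℝ → ℝ and every (z, e) ∈ ℝⁿ × ℝ, the Jacobi identity holds: {{F₁, F₂}, F₃}(z,e) + {{F₃, F₁}, F₂}(z,e) + {{F₂, F₃}, F₁}(z,e) = 0. -/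
open scoped RealInnerProductSpace

/-- The Poisson-type bracket `{F,G} = ⟨dF, L̂ dG⟩` associated with the operator
`L̂(z,e)(ξ,r) = (r·W(z), −⟨W(z), ξ⟩)`:
`{F,G}(z,e) = ∂ₑG(z,e)·⟨W(z), ∇_z F(z,e)⟩ − ∂ₑF(z,e)·⟨W(z), ∇_z G(z,e)⟩`. -/
noncomputable def bracketHat {n : ℕ}
    (W : EuclideanSpace ℝ (Fin n) → EuclideanSpace ℝ (Fin n))
    (F G : EuclideanSpace ℝ (Fin n) × ℝ → ℝ) :
    EuclideanSpace ℝ (Fin n) × ℝ → ℝ :=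
  fun p =>
    deriv (fun e => G (p.1, e)) p.2 * ⟪W p.1, gradient (fun z => F (z, p.2)) p.1⟫ -
      deriv (fun e => F (p.1, e)) p.2 * ⟪W p.1, gradient (fun z => G (z, p.2)) p.1⟫

theorem deriv_snd_eq_fderiv {E : Type*} [NormedAddCommGroup E] [NormedSpace ℝ E]
    {F : E × ℝ → ℝ} {p : E × ℝ} (hF : DifferentiableAt ℝ F p) :
    deriv (fun e => F (p.1, e)) p.2 = fderiv ℝ F p (0, 1) := by
  have h : HasDerivAt (fun e : ℝ => (p.1, e)) ((0 : E), (1 : ℝ)) p.2 :=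
    (hasDerivAt_const p.2 p.1).prodMk (hasDerivAt_id p.2)
  exact (hF.hasFDerivAt.comp_hasDerivAt p.2 h).deriv

theorem inner_gradient_fst_eq_fderiv {E : Type*} [NormedAddCommGroup E]
    [InnerProductSpace ℝ E] [CompleteSpace E]
    {F : E × ℝ → ℝ} {p : E × ℝ} (hF : DifferentiableAt ℝ F p) (w : E) :
    ⟪w, gradient (fun z => F (z, p.2)) p.1⟫ = fderiv ℝ F p (w, 0) := by
  have h : HasFDerivAt (fun z => F (z, p.2))
      ((fderiv ℝ F p).comp (ContinuousLinearMap.inl ℝ E ℝ)) p.1 :=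
    hF.hasFDerivAt.comp p.1 (hasFDerivAt_prodMk_left p.1 p.2)
  rw [real_inner_comm, gradient, InnerProductSpace.toDual_symm_apply, h.fderiv]
  simp

theorem bracketHat_apply_eq_fderiv {n : ℕ}
    (W : EuclideanSpace ℝ (Fin n) → EuclideanSpace ℝ (Fin n))
    {F G : EuclideanSpace ℝ (Fin n) × ℝ → ℝ} {p : EuclideanSpace ℝ (Fin n) × ℝ}
    (hF : DifferentiableAt ℝ F p) (hG : DifferentiableAt ℝ G p) :
    bracketHat W F G p =
      fderiv ℝ G p (0, 1) * fderiv ℝ F p (W p.1, 0) -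
        fderiv ℝ F p (0, 1) * fderiv ℝ G p (W p.1, 0) := by
  rw [bracketHat, deriv_snd_eq_fderiv hF, deriv_snd_eq_fderiv hG,
    inner_gradient_fst_eq_fderiv hF, inner_gradient_fst_eq_fderiv hG]

theorem bracketHat_eq_fderiv {n : ℕ}
    (W : EuclideanSpace ℝ (Fin n) → EuclideanSpace ℝ (Fin n))
    {F G : EuclideanSpace ℝ (Fin n) × ℝ → ℝ}
    (hF : Differentiable ℝ F) (hG : Differentiable ℝ G) :
    bracketHat W F G = fun q =>
      fderiv ℝ G q (0, 1) * fderiv ℝ F q (W q.1, 0) -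
        fderiv ℝ F q (0, 1) * fderiv ℝ G q (W q.1, 0) :=
  funext fun q => bracketHat_apply_eq_fderiv W (hF q) (hG q)

theorem ContDiff.differentiable_fderiv_of_two {E F : Type*} [NormedAddCommGroup E]
    [NormedSpace ℝ E] [NormedAddCommGroup F] [NormedSpace ℝ F] {f : E → F}
    (hf : ContDiff ℝ 2 f) : Differentiable ℝ (fderiv ℝ f) :=
  (hf.fderiv_right (m := 1) (by norm_num)).differentiable one_ne_zero

theorem differentiable_fderiv_apply_fst {E : Type*} [NormedAddCommGroup E] [NormedSpace ℝ E]
    {W : E → E} (hW : Differentiable ℝ W) {F : E × ℝ → ℝ} (hF : ContDiff ℝ 2 F) :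
    Differentiable ℝ fun q : E × ℝ => fderiv ℝ F q (W q.1, 0) :=
  hF.differentiable_fderiv_of_two.clm_apply
    ((hW.comp differentiable_fst).prodMk (differentiable_const 0))

theorem differentiable_fderiv_apply_const {E : Type*} [NormedAddCommGroup E] [NormedSpace ℝ E]
    {F : E → ℝ} (hF : ContDiff ℝ 2 F) (v : E) :
    Differentiable ℝ fun q => fderiv ℝ F q v :=
  hF.differentiable_fderiv_of_two.clm_apply (differentiable_const v)

/-- The vector fields `(W, 0)` and `(0, 1)` on `E × ℝ` commute. -/
theorem fderiv_fderiv_apply_fst_comm {E : Type*} [NormedAddCommGroup E] [NormedSpace ℝ E]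
    {W : E → E} (hW : Differentiable ℝ W) {F : E × ℝ → ℝ} (hF : ContDiff ℝ 2 F) (p : E × ℝ) :
    fderiv ℝ (fun q : E × ℝ => fderiv ℝ F q (W q.1, 0)) p (0, 1) =
      fderiv ℝ (fun q : E × ℝ => fderiv ℝ F q (0, 1)) p (W p.1, 0) := by
  have hD := (hF.differentiable_fderiv_of_two p).hasFDerivAt
  have hX : HasFDerivAt (fun q : E × ℝ => (W q.1, (0 : ℝ)))
      (((fderiv ℝ W p.1).comp (ContinuousLinearMap.fst ℝ E ℝ)).prod 0) p :=
    ((hW p.1).hasFDerivAt.comp p hasFDerivAt_fst).prodMk (hasFDerivAt_const 0 p)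
  have hsymm : IsSymmSndFDerivAt ℝ F p :=
    hF.contDiffAt.isSymmSndFDerivAt (by simp)
  rw [(hD.clm_apply hX).fderiv, (hD.clm_apply (hasFDerivAt_const ((0 : E), (1 : ℝ)) p)).fderiv]
  simpa [Prod.mk_zero_zero] using hsymm.eq (0, 1) (W p.1, 0)

theorem differentiable_bracketHat {n : ℕ}
    {W : EuclideanSpace ℝ (Fin n) → EuclideanSpace ℝ (Fin n)} (hW : Differentiable ℝ W)
    {F G : EuclideanSpace ℝ (Fin n) × ℝ → ℝ} (hF : ContDiff ℝ 2 F) (hG : ContDiff ℝ 2 G) :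
    Differentiable ℝ (bracketHat W F G) := by
  rw [bracketHat_eq_fderiv W (hF.differentiable two_ne_zero) (hG.differentiable two_ne_zero)]
  exact ((differentiable_fderiv_apply_const hG _).mul (differentiable_fderiv_apply_fst hW hF)).sub
    ((differentiable_fderiv_apply_const hF _).mul (differentiable_fderiv_apply_fst hW hG))

theorem fderiv_bracketHat_apply {n : ℕ}
    {W : EuclideanSpace ℝ (Fin n) → EuclideanSpace ℝ (Fin n)} (hW : Differentiable ℝ W)
    {F G : EuclideanSpace ℝ (Fin n) × ℝ → ℝ} (hF : ContDiff ℝ 2 F) (hG : ContDiff ℝ 2 G)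
    (p v : EuclideanSpace ℝ (Fin n) × ℝ) :
    fderiv ℝ (bracketHat W F G) p v =
      (fderiv ℝ G p (0, 1) * fderiv ℝ (fun q => fderiv ℝ F q (W q.1, 0)) p v +
        fderiv ℝ F p (W p.1, 0) * fderiv ℝ (fun q => fderiv ℝ G q (0, 1)) p v) -
      (fderiv ℝ F p (0, 1) * fderiv ℝ (fun q => fderiv ℝ G q (W q.1, 0)) p v +
        fderiv ℝ G p (W p.1, 0) * fderiv ℝ (fun q => fderiv ℝ F q (0, 1)) p v) := by
  rw [bracketHat_eq_fderiv W (hF.differentiable two_ne_zero) (hG.differentiable two_ne_zero)]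
  have h := ((differentiable_fderiv_apply_const hG (0, 1) p).hasFDerivAt.mul
    (differentiable_fderiv_apply_fst hW hF p).hasFDerivAt).sub
    ((differentiable_fderiv_apply_const hF (0, 1) p).hasFDerivAt.mul
      (differentiable_fderiv_apply_fst hW hG p).hasFDerivAt)
  exact congrArg (fun L => L v) h.fderiv

/-- Proposition A.1: the bracket associated with the extended operator
`L̂(z,e)(ξ,r) = (r·W(z), −⟨W(z), ξ⟩)` satisfies the Jacobi identity. -/
theorem bracketHat_jacobi_identity (n : ℕ)
    (W : EuclideanSpace ℝ (Fin n) → EuclideanSpace ℝ (Fin n))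
    (hW : ContDiff ℝ 1 W)
    (F₁ F₂ F₃ : EuclideanSpace ℝ (Fin n) × ℝ → ℝ)
    (h₁ : ContDiff ℝ 2 F₁) (h₂ : ContDiff ℝ 2 F₂) (h₃ : ContDiff ℝ 2 F₃)
    (p : EuclideanSpace ℝ (Fin n) × ℝ) :
    bracketHat W (bracketHat W F₁ F₂) F₃ p +
      bracketHat W (bracketHat W F₃ F₁) F₂ p +
      bracketHat W (bracketHat W F₂ F₃) F₁ p = 0 := by
  have hW' : Differentiable ℝ W := hW.differentiable one_ne_zero
  rw [bracketHat_apply_eq_fderiv W (differentiable_bracketHat hW' h₁ h₂ p)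
      (h₃.differentiable two_ne_zero p),
    bracketHat_apply_eq_fderiv W (differentiable_bracketHat hW' h₃ h₁ p)
      (h₂.differentiable two_ne_zero p),
    bracketHat_apply_eq_fderiv W (differentiable_bracketHat hW' h₂ h₃ p)
      (h₁.differentiable two_ne_zero p)]
  simp only [fderiv_bracketHat_apply hW' h₁ h₂, fderiv_bracketHat_apply hW' h₃ h₁,
    fderiv_bracketHat_apply hW' h₂ h₃, fderiv_fderiv_apply_fst_comm hW' h₁,
    fderiv_fderiv_apply_fst_comm hW' h₂, fderiv_fderiv_apply_fst_comm hW' h₃]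
  ring
end

section
/- Let S : ℝⁿ → ℝ be differentiable with gradient ∇S, W : ℝⁿ → ℝⁿ with ⟨W(z), ∇S(z)⟩ = 0 for all z, and Ψ* : ℝⁿ × ℝⁿ → ℝ symmetric (Ψ*(z,ξ) = Ψ*(z,−ξ)) with second-variable Legendre transform Ψ, assumed finite. Suppose F : ℝⁿ → ℝⁿ is pre-GENERIC: Ψ(z, F(z) − W(z)) + Ψ*(z, −½∇S(z)) + ½⟨F(z), ∇S(z)⟩ = 0 for all z. On ℝⁿ × ℝ define Ŝ(z,a) := S(z), Ê(z,a) := a, Ψ̂*((z,a),(ξ,r)) := Ψ*(z,ξ), F̂(z,a) := (F(z), 0), and L̂(z,a)(ξ,r) := (r·W(z), −⟨W(z), ξ⟩). Then: (i) L̂ is antisymmetric: ⟨(ξ₁,r₁), L̂(z,a)(ξ₂,r₂)⟩ = −⟨(ξ₂,r₂), L̂(z,a)(ξ₁,r₁)⟩ for all arguments; (ii) L̂(z,a)(∇S(z), 0) = 0, i.e. L̂ dŜ = 0; (iii) Ψ̂*((z,a), (ξ,r) + α(0,1)) = Ψ̂*((z,a),(ξ,r)) for all α ∈ ℝ, i.e.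 Ψ̂* is invariant in the direction dÊ = (0,1); (iv) the Legendre transform Ψ̂ of Ψ̂*((z,a), ·) over ℝⁿ × ℝ (with values in ℝ ∪ {+∞}) satisfies Ψ̂((z,a),(v,s)) = Ψ(z,v) if s = 0 and Ψ̂((z,a),(v,s)) = +∞ otherwise; (v) F̂ satisfies the GENERIC equation: with L̂(z,a)(0,1) = (W(z), 0), one has Ψ̂((z,a), F̂(z,a) − (W(z),0)) + Ψ̂*((z,a), −½(∇S(z),0)) + ½⟨F̂(z,a), (∇S(z),0)⟩ = 0. -/
open scoped RealInnerProductSpace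

/-- Theorem 4.1(b): every pre-GENERIC system becomes GENERIC after adding a trivial
energy variable. -/
theorem preGENERIC_to_GENERIC_trivial_extension (n : ℕ)
    (S : EuclideanSpace ℝ (Fin n) → ℝ)
    (gradS : EuclideanSpace ℝ (Fin n) → EuclideanSpace ℝ (Fin n))
    (hS : ∀ z, HasGradientAt S (gradS z) z)
    (W : EuclideanSpace ℝ (Fin n) → EuclideanSpace ℝ (Fin n))
    (hWorth : ∀ z, ⟪W z, gradS z⟫ = 0)
    (Ψstar : EuclideanSpace ℝ (Fin n) → EuclideanSpace ℝ (Fin n) → ℝ)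
    (hΨstarSym : ∀ z ξ, Ψstar z ξ = Ψstar z (-ξ))
    (Ψ : EuclideanSpace ℝ (Fin n) → EuclideanSpace ℝ (Fin n) → ℝ)
    (hΨ : ∀ z v, IsLUB {y : ℝ | ∃ ξ, y = ⟪v, ξ⟫ - Ψstar z ξ} (Ψ z v))
    (F : EuclideanSpace ℝ (Fin n) → EuclideanSpace ℝ (Fin n))
    (hpre : ∀ z, Ψ z (F z - W z) + Ψstar z (-(2⁻¹ : ℝ) • gradS z)
      + (2⁻¹ : ℝ) * ⟪F z, gradS z⟫ = 0)
    -- the extended objects on ℝⁿ × ℝ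
    (Shat Ehat : EuclideanSpace ℝ (Fin n) × ℝ → ℝ)
    (hShat : ∀ z a, Shat (z, a) = S z)
    (hEhat : ∀ z a, Ehat (z, a) = a)
    (Psihatstar : EuclideanSpace ℝ (Fin n) × ℝ →
      EuclideanSpace ℝ (Fin n) × ℝ → ℝ)
    (hPsihatstar : ∀ (z : EuclideanSpace ℝ (Fin n)) (a : ℝ)
      (ξ : EuclideanSpace ℝ (Fin n)) (r : ℝ),
      Psihatstar (z, a) (ξ, r) = Ψstar z ξ)
    (Fhat : EuclideanSpace ℝ (Fin n) × ℝ → EuclideanSpace ℝ (Fin n) × ℝ)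
    (hFhat : ∀ z a, Fhat (z, a) = (F z, (0 : ℝ)))
    (Lhat : EuclideanSpace ℝ (Fin n) × ℝ →
      EuclideanSpace ℝ (Fin n) × ℝ → EuclideanSpace ℝ (Fin n) × ℝ)
    (hLhat : ∀ (z : EuclideanSpace ℝ (Fin n)) (a : ℝ)
      (ξ : EuclideanSpace ℝ (Fin n)) (r : ℝ),
      Lhat (z, a) (ξ, r) = (r • W z, -⟪W z, ξ⟫))
    (Psihat : EuclideanSpace ℝ (Fin n) × ℝ →
      EuclideanSpace ℝ (Fin n) × ℝ → EReal)
    (hPsihat : ∀ p q : EuclideanSpace ℝ (Fin n) × ℝ,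
      Psihat p q = ⨆ w : EuclideanSpace ℝ (Fin n) × ℝ,
        ((⟪q.1, w.1⟫ + q.2 * w.2 - Psihatstar p w : ℝ) : EReal)) :
    -- (i) L̂ is antisymmetric
    (∀ (p q₁ q₂ : EuclideanSpace ℝ (Fin n) × ℝ),
      ⟪q₁.1, (Lhat p q₂).1⟫ + q₁.2 * (Lhat p q₂).2
        = -(⟪q₂.1, (Lhat p q₁).1⟫ + q₂.2 * (Lhat p q₁).2)) ∧
    -- (ii) L̂ dŜ = 0
    (∀ (z : EuclideanSpace ℝ (Fin n)) (a : ℝ),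
      Lhat (z, a) (gradS z, (0 : ℝ)) = 0) ∧
    -- (iii) Ψ̂* is invariant in the direction dÊ = (0,1)
    (∀ (p q : EuclideanSpace ℝ (Fin n) × ℝ) (α : ℝ),
      Psihatstar p (q + α • ((0 : EuclideanSpace ℝ (Fin n)), (1 : ℝ)))
        = Psihatstar p q) ∧
    -- (iv) the extended primal potential
    (∀ (z : EuclideanSpace ℝ (Fin n)) (a : ℝ)
      (v : EuclideanSpace ℝ (Fin n)) (s : ℝ),
      (s = 0 → Psihat (z, a) (v, s) = ((Ψ z v : ℝ) : EReal)) ∧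
      (s ≠ 0 → Psihat (z, a) (v, s) = ⊤)) ∧
    -- (v) the GENERIC equation for F̂
    (∀ (z : EuclideanSpace ℝ (Fin n)) (a : ℝ),
      Lhat (z, a) ((0 : EuclideanSpace ℝ (Fin n)), (1 : ℝ)) = (W z, (0 : ℝ)) ∧
      Psihat (z, a) (Fhat (z, a) - (W z, (0 : ℝ)))
        + ((Psihatstar (z, a) (-(2⁻¹ : ℝ) • (gradS z, (0 : ℝ))) : ℝ) : EReal)
        + (((2⁻¹ : ℝ) * (⟪(Fhat (z, a)).1, gradS z⟫ + (Fhat (z, a)).2 * 0) : ℝ) : EReal)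
        = (0 : EReal)) := by
  have hPsihat_zero : ∀ z a v, Psihat (z, a) (v, 0) = ((Ψ z v : ℝ) : EReal) := by
    intro z a v
    rw [hPsihat]
    apply le_antisymm
    · refine iSup_le fun w => EReal.coe_le_coe_iff.2 ((hΨ z v).1 ⟨w.1, ?_⟩)
      rw [← hPsihatstar z a w.1 w.2]
      simp
    · refine EReal.le_of_forall_lt_iff_le.1 fun b hb => EReal.coe_le_coe_iff.2 ?_
      refine (hΨ z v).2 ?_
      rintro _ ⟨ξ, rfl⟩
      have h := (le_iSup (fun w : EuclideanSpace ℝ (Fin n) × ℝ =>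
        ((⟪v, w.1⟫ + 0 * w.2 - Psihatstar (z, a) w : ℝ) : EReal)) (ξ, 0)).trans hb.le
      rw [EReal.coe_le_coe_iff, hPsihatstar] at h
      simpa using h
  have hPsihat_top : ∀ z a v s, s ≠ 0 → Psihat (z, a) (v, s) = ⊤ := by
    intro z a v s hs
    rw [hPsihat, EReal.eq_top_iff_forall_lt]
    intro y
    refine lt_of_lt_of_le ?_ (le_iSup _ ((0 : EuclideanSpace ℝ (Fin n)), (y + 1 + Ψstar z 0) / s))
    rw [EReal.coe_lt_coe_iff, hPsihatstar, inner_zero_right, mul_div_cancel₀ _ hs]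
    linarith
  refine ⟨?_, ?_, ?_, ?_, ?_⟩
  · rintro ⟨z, a⟩ ⟨ξ₁, r₁⟩ ⟨ξ₂, r₂⟩
    simp only [hLhat, real_inner_smul_right, real_inner_comm (W z)]
    ring
  · intro z a
    simp [hLhat, hWorth]
  · rintro ⟨z, a⟩ ⟨ξ, r⟩ α
    simp [hPsihatstar]
  · rintro z a v s
    exact ⟨fun hs => hs ▸ hPsihat_zero z a v, hPsihat_top z a v s⟩
  · intro z a
    refine ⟨by simp [hLhat], ?_⟩
    rw [hFhat, Prod.mk_sub_mk, sub_zero, hPsihat_zero, Prod.smul_mk, hPsihatstar, zero_mul, add_zero]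
    exact_mod_cast hpre z
end

section
/- Let S : ℝⁿ → ℝ be differentiable with gradient ∇S, W : ℝⁿ → ℝⁿ with ⟨W(z), ∇S(z)⟩ = 0 for all z, and let ℋ₂ : ℝⁿ × ℝⁿ → ℝ be reversible with respect to S, i.e. ℋ₂(z,ξ) = ℋ₂(z, ∇S(z) − ξ) for all z, ξ. Set ℋ(z,ξ) := ⟨W(z), ξ⟩ + ℋ₂(z,ξ) with second-variable Legendre transform 𝓛, assumed finite, and let F : ℝⁿ → ℝⁿ satisfy 𝓛(z, F(z)) = 0 for all z. On ℝⁿ × ℝ define Ŝ(z,a) := S(z), Ê(z,a) := a, ℋ̂₂((z,a),(ξ,r)) := ℋ₂(z,ξ), L̂(z,a)(ξ,r) := (r·W(z), −⟨W(z), ξ⟩), ℋ̂((z,a),(ξ,r)) := ⟨ξ, W(z)⟩ + ℋ₂(z,ξ), and let 𝓛̂ be the Legendre transform of ℋ̂((z,a), ·) over ℝⁿ × ℝ, with values in ℝ ∪ {+∞}. Then: (i) ℋ̂₂ is reversible with respect to Ŝ: ℋ̂₂((z,a),(ξ,r)) = ℋ̂₂((z,a), (∇S(z),0) − (ξ,r));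 (ii) L̂(z,a)(∇S(z),0) = 0; (iii) ℋ̂₂((z,a), (ξ,r) + α(0,1)) = ℋ̂₂((z,a),(ξ,r)) for all α ∈ ℝ, i.e. ℋ̂₂ is constant in the direction dÊ; (iv) ℋ̂₁((z,a),(ξ,r)) := ⟨(ξ,r), L̂(z,a)(0,1)⟩ equals ⟨ξ, W(z)⟩, so ℋ̂ = ℋ̂₁ + ℋ̂₂; (v) 𝓛̂((z,a),(v,s)) = 𝓛(z,v) if s = 0 and +∞ otherwise; in particular 𝓛̂((z,a), (F(z), 0)) = 0, i.e. F̂ = (F, 0) is the zero-cost flow for 𝓛̂. -/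
open scoped RealInnerProductSpace

/-- A real least upper bound is also the supremum in the extended reals. -/
lemma EReal.iSup_coe_eq_of_isLUB {ι : Type*} {f : ι → ℝ} {b : ℝ}
    (h : IsLUB (Set.range f) b) : ⨆ i, (f i : EReal) = b := by
  refine le_antisymm (iSup_le fun i => EReal.coe_le_coe_iff.2 (h.1 ⟨i, rfl⟩)) ?_
  refine EReal.le_of_forall_lt_iff_le.1 fun c hc => EReal.coe_le_coe_iff.2 (h.2 ?_)
  rintro _ ⟨j, rfl⟩
  exact EReal.coe_le_coe_iff.1 ((le_iSup (fun i => (f i : EReal)) j).trans hc.le)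

/-- An affine function of a real variable with nonzero slope is unbounded above. -/
lemma EReal.iSup_coe_add_mul_eq_top {s : ℝ} (hs : s ≠ 0) (c : ℝ) :
    ⨆ r : ℝ, ((c + s * r : ℝ) : EReal) = ⊤ := by
  refine EReal.eq_top_iff_forall_lt _ |>.2 fun y => ?_
  refine lt_of_lt_of_le ?_ (le_iSup (fun r : ℝ => ((c + s * r : ℝ) : EReal)) ((y + 1 - c) / s))
  rw [EReal.coe_lt_coe_iff, mul_div_cancel₀ _ hs]
  linarith

/-- Theorem 4.1(a): the Hamiltonian-side statement of the trivial extension of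
pre-GENERIC to GENERIC by adding an energy variable. -/
theorem preGENERIC_to_GENERIC_trivial_extension_hamiltonian (n : ℕ)
    (S : EuclideanSpace ℝ (Fin n) → ℝ)
    (gradS : EuclideanSpace ℝ (Fin n) → EuclideanSpace ℝ (Fin n))
    (hS : ∀ z, HasGradientAt S (gradS z) z)
    (W : EuclideanSpace ℝ (Fin n) → EuclideanSpace ℝ (Fin n))
    (hWorth : ∀ z, ⟪W z, gradS z⟫ = 0)
    (H₂ : EuclideanSpace ℝ (Fin n) → EuclideanSpace ℝ (Fin n) → ℝ)
    (hrev : ∀ z ξ, H₂ z ξ = H₂ z (gradS z - ξ))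
    (H : EuclideanSpace ℝ (Fin n) → EuclideanSpace ℝ (Fin n) → ℝ)
    (hH : ∀ z ξ, H z ξ = ⟪W z, ξ⟫ + H₂ z ξ)
    (𝓛 : EuclideanSpace ℝ (Fin n) → EuclideanSpace ℝ (Fin n) → ℝ)
    (h𝓛 : ∀ z v, IsLUB {y : ℝ | ∃ ξ, y = ⟪v, ξ⟫ - H z ξ} (𝓛 z v))
    (F : EuclideanSpace ℝ (Fin n) → EuclideanSpace ℝ (Fin n))
    (hF : ∀ z, 𝓛 z (F z) = 0)
    -- the extended objects on ℝⁿ × ℝ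
    (Shat Ehat : EuclideanSpace ℝ (Fin n) × ℝ → ℝ)
    (hShat : ∀ z a, Shat (z, a) = S z)
    (hEhat : ∀ z a, Ehat (z, a) = a)
    (Hhat₂ : EuclideanSpace ℝ (Fin n) × ℝ → EuclideanSpace ℝ (Fin n) × ℝ → ℝ)
    (hHhat₂ : ∀ (z : EuclideanSpace ℝ (Fin n)) (a : ℝ)
      (ξ : EuclideanSpace ℝ (Fin n)) (r : ℝ), Hhat₂ (z, a) (ξ, r) = H₂ z ξ)
    (Lhat : EuclideanSpace ℝ (Fin n) × ℝ →
      EuclideanSpace ℝ (Fin n) × ℝ → EuclideanSpace ℝ (Fin n) × ℝ)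
    (hLhat : ∀ (z : EuclideanSpace ℝ (Fin n)) (a : ℝ)
      (ξ : EuclideanSpace ℝ (Fin n)) (r : ℝ),
      Lhat (z, a) (ξ, r) = (r • W z, -⟪W z, ξ⟫))
    (Hhat : EuclideanSpace ℝ (Fin n) × ℝ → EuclideanSpace ℝ (Fin n) × ℝ → ℝ)
    (hHhat : ∀ (z : EuclideanSpace ℝ (Fin n)) (a : ℝ)
      (ξ : EuclideanSpace ℝ (Fin n)) (r : ℝ),
      Hhat (z, a) (ξ, r) = ⟪ξ, W z⟫ + H₂ z ξ)
    (Lagrhat : EuclideanSpace ℝ (Fin n) × ℝ →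
      EuclideanSpace ℝ (Fin n) × ℝ → EReal)
    (hLagrhat : ∀ p q : EuclideanSpace ℝ (Fin n) × ℝ,
      Lagrhat p q = ⨆ w : EuclideanSpace ℝ (Fin n) × ℝ,
        ((⟪q.1, w.1⟫ + q.2 * w.2 - Hhat p w : ℝ) : EReal)) :
    -- (i) Ĥ₂ is reversible with respect to Ŝ
    (∀ (z : EuclideanSpace ℝ (Fin n)) (a : ℝ)
      (ξ : EuclideanSpace ℝ (Fin n)) (r : ℝ),
      Hhat₂ (z, a) (ξ, r) = Hhat₂ (z, a) ((gradS z, (0 : ℝ)) - (ξ, r))) ∧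
    -- (ii) L̂ dŜ = 0
    (∀ (z : EuclideanSpace ℝ (Fin n)) (a : ℝ),
      Lhat (z, a) (gradS z, (0 : ℝ)) = 0) ∧
    -- (iii) Ĥ₂ is constant in the direction dÊ = (0,1)
    (∀ (p q : EuclideanSpace ℝ (Fin n) × ℝ) (α : ℝ),
      Hhat₂ p (q + α • ((0 : EuclideanSpace ℝ (Fin n)), (1 : ℝ))) = Hhat₂ p q) ∧
    -- (iv) Ĥ₁ := ⟨·, L̂(0,1)⟩ equals ⟨ξ, W⟩ and Ĥ = Ĥ₁ + Ĥ₂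
    (∀ (z : EuclideanSpace ℝ (Fin n)) (a : ℝ)
      (ξ : EuclideanSpace ℝ (Fin n)) (r : ℝ),
      (⟪ξ, (Lhat (z, a) ((0 : EuclideanSpace ℝ (Fin n)), (1 : ℝ))).1⟫
          + r * (Lhat (z, a) ((0 : EuclideanSpace ℝ (Fin n)), (1 : ℝ))).2
        = ⟪ξ, W z⟫) ∧
      Hhat (z, a) (ξ, r)
        = (⟪ξ, (Lhat (z, a) ((0 : EuclideanSpace ℝ (Fin n)), (1 : ℝ))).1⟫
            + r * (Lhat (z, a) ((0 : EuclideanSpace ℝ (Fin n)), (1 : ℝ))).2)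
          + Hhat₂ (z, a) (ξ, r)) ∧
    -- (v) the extended Lagrangian and the zero-cost flow
    ((∀ (z : EuclideanSpace ℝ (Fin n)) (a : ℝ)
        (v : EuclideanSpace ℝ (Fin n)) (s : ℝ),
        (s = 0 → Lagrhat (z, a) (v, s) = ((𝓛 z v : ℝ) : EReal)) ∧
        (s ≠ 0 → Lagrhat (z, a) (v, s) = ⊤)) ∧
      ∀ (z : EuclideanSpace ℝ (Fin n)) (a : ℝ),
        Lagrhat (z, a) (F z, (0 : ℝ)) = (0 : EReal)) := by
  have hzero : ∀ z a v, Lagrhat (z, a) (v, 0) = ((𝓛 z v : ℝ) : EReal) := by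
    intro z a v
    rw [hLagrhat]
    refine EReal.iSup_coe_eq_of_isLUB ?_
    convert h𝓛 z v using 1
    ext y
    simp [hHhat, hH, real_inner_comm (W z), eq_comm]
  refine ⟨fun z a ξ r => ?_, fun z a => ?_, fun p q α => ?_, fun z a ξ r => ?_,
    fun z a v s => ⟨?_, fun hs => ?_⟩, fun z a => ?_⟩
  · rw [Prod.mk_sub_mk, hHhat₂, hHhat₂, ← hrev]
  · simp [hLhat, hWorth]
  · obtain ⟨z, a⟩ := p
    obtain ⟨ξ, r⟩ := q
    simp [hHhat₂]
  · simp [hLhat, hHhat, hHhat₂]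
  · rintro rfl
    exact hzero z a v
  · rw [eq_top_iff, hLagrhat, ← EReal.iSup_coe_add_mul_eq_top hs (-H₂ z 0)]
    refine iSup_le fun r => le_iSup_of_le (0, r) (le_of_eq ?_)
    simp [hHhat, neg_add_eq_sub]
  · rw [hzero, hF, EReal.coe_zero]
end

section
/- Let S, E : ℝⁿ → ℝ be differentiable with gradients ∇S, ∇E, let L(z) : ℝⁿ → ℝⁿ be a family of linear maps with ⟨L(z)ξ, η⟩ = −⟨L(z)η, ξ⟩ and L(z)(∇S(z) − ∇E(z)) = 0 for all z, ξ, η, and set W(z) := L(z)∇E(z). Let Ψ* : ℝⁿ × ℝⁿ → ℝ be symmetric (Ψ*(z,ξ) = Ψ*(z,−ξ)) with second-variable Legendre transform Ψ, assumed finite, and let F : ℝⁿ → ℝⁿ satisfy the pre-GENERIC equation Ψ(z, F(z) − W(z)) + Ψ*(z, −½∇S(z)) + ½⟨F(z), ∇S(z)⟩ = 0 for all z. On ℝⁿ × ℝ define Ē(z,e) := E(z) + e, S̄(z,e) := S(z) − (E(z) + e), Ψ̄*((z,e),(ξ,r)) := Ψ*(z, ξ − r·∇E(z)), L̄(z,e)(ξ,r)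 := (L(z)ξ, 0), F̄(z,e) := (F(z), −⟨∇E(z), F(z)⟩), and let Ψ̄ be the Legendre transform of Ψ̄*((z,e), ·) over ℝⁿ × ℝ (values in ℝ ∪ {+∞}). Then F̄ is GENERIC for (S̄, Ē, Ψ̄, Ψ̄*, L̄): (i) L̄ is antisymmetric; (ii) L̄(z,e) dS̄(z,e) = 0, where dS̄(z,e) = (∇S(z) − ∇E(z), −1); (iii) Ψ̄*((z,e), (ξ,r) + α dĒ(z,e)) = Ψ̄*((z,e),(ξ,r)) for all α ∈ ℝ, where dĒ(z,e) = (∇E(z), 1); (iv) the GENERIC equation holds: Ψ̄((z,e), F̄(z,e) − L̄(z,e) dĒ(z,e)) + Ψ̄*((z,e), −½ dS̄(z,e)) + ½⟨F̄(z,e), dS̄(z,e)⟩ = 0. -/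
open scoped RealInnerProductSpace

/-- If `v.2 = -⟪g, v.1⟫`, then the Legendre transform at `v` of `(ξ, r) ↦ φ (ξ - r • g)`
is the Legendre transform of `φ` at `v.1`. -/
lemma iSup_inner_add_mul_sub_comp_sub_smul {V : Type*} [NormedAddCommGroup V]
    [InnerProductSpace ℝ V] {φ : V → ℝ} {g : V} {v : V × ℝ} {a : ℝ}
    (hv : v.2 = -⟪g, v.1⟫) (ha : IsLUB {y : ℝ | ∃ ξ, y = ⟪v.1, ξ⟫ - φ ξ} a) :
    ⨆ w : V × ℝ, ((⟪v.1, w.1⟫ + v.2 * w.2 - φ (w.1 - w.2 • g) : ℝ) : EReal) = a := by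
  have key (w : V × ℝ) : ⟪v.1, w.1⟫ + v.2 * w.2 = ⟪v.1, w.1 - w.2 • g⟫ := by
    rw [hv, inner_sub_right, real_inner_smul_right, real_inner_comm v.1 g]
    ring
  simp only [key]
  refine le_antisymm (iSup_le fun w => EReal.coe_le_coe_iff.2 (ha.1 ⟨_, rfl⟩)) ?_
  refine EReal.le_of_forall_lt_iff_le.1 fun c hc => ?_
  refine EReal.coe_le_coe_iff.2 (ha.2 ?_)
  rintro _ ⟨ξ, rfl⟩
  refine EReal.coe_le_coe_iff.1 (le_trans ?_ hc.le)
  simpa using le_iSup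
    (fun w : V × ℝ => ((⟪v.1, w.1 - w.2 • g⟫ - φ (w.1 - w.2 • g) : ℝ) : EReal)) (ξ, 0)

/-- Theorem 4.2: the physically natural extension of a pre-GENERIC system with
`W = L ∇E` to a GENERIC system by adding the heat-bath energy variable `e`. -/
theorem preGENERIC_to_GENERIC_natural_extension (n : ℕ)
    (S E : EuclideanSpace ℝ (Fin n) → ℝ)
    (gradS gradE : EuclideanSpace ℝ (Fin n) → EuclideanSpace ℝ (Fin n))
    (hS : ∀ z, HasGradientAt S (gradS z) z)
    (hE : ∀ z, HasGradientAt E (gradE z) z)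
    (L : EuclideanSpace ℝ (Fin n) →
      EuclideanSpace ℝ (Fin n) →ₗ[ℝ] EuclideanSpace ℝ (Fin n))
    (hLanti : ∀ z ξ η, ⟪L z ξ, η⟫ = -⟪L z η, ξ⟫)
    (hLSE : ∀ z, L z (gradS z - gradE z) = 0)
    (W : EuclideanSpace ℝ (Fin n) → EuclideanSpace ℝ (Fin n))
    (hW : ∀ z, W z = L z (gradE z))
    (Ψstar : EuclideanSpace ℝ (Fin n) → EuclideanSpace ℝ (Fin n) → ℝ)
    (hΨstarSym : ∀ z ξ, Ψstar z ξ = Ψstar z (-ξ))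
    (Ψ : EuclideanSpace ℝ (Fin n) → EuclideanSpace ℝ (Fin n) → ℝ)
    (hΨ : ∀ z v, IsLUB {y : ℝ | ∃ ξ, y = ⟪v, ξ⟫ - Ψstar z ξ} (Ψ z v))
    (F : EuclideanSpace ℝ (Fin n) → EuclideanSpace ℝ (Fin n))
    (hpre : ∀ z, Ψ z (F z - W z) + Ψstar z (-(2⁻¹ : ℝ) • gradS z)
      + (2⁻¹ : ℝ) * ⟪F z, gradS z⟫ = 0)
    -- the extended objects on ℝⁿ × ℝ
    (Ebar Sbar : EuclideanSpace ℝ (Fin n) × ℝ → ℝ)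
    (hEbar : ∀ z e, Ebar (z, e) = E z + e)
    (hSbar : ∀ z e, Sbar (z, e) = S z - (E z + e))
    (Psibarstar : EuclideanSpace ℝ (Fin n) × ℝ →
      EuclideanSpace ℝ (Fin n) × ℝ → ℝ)
    (hPsibarstar : ∀ (z : EuclideanSpace ℝ (Fin n)) (e : ℝ)
      (ξ : EuclideanSpace ℝ (Fin n)) (r : ℝ),
      Psibarstar (z, e) (ξ, r) = Ψstar z (ξ - r • gradE z))
    (Lbar : EuclideanSpace ℝ (Fin n) × ℝ →
      EuclideanSpace ℝ (Fin n) × ℝ → EuclideanSpace ℝ (Fin n) × ℝ)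
    (hLbar : ∀ (z : EuclideanSpace ℝ (Fin n)) (e : ℝ)
      (ξ : EuclideanSpace ℝ (Fin n)) (r : ℝ),
      Lbar (z, e) (ξ, r) = (L z ξ, (0 : ℝ)))
    (Fbar : EuclideanSpace ℝ (Fin n) × ℝ → EuclideanSpace ℝ (Fin n) × ℝ)
    (hFbar : ∀ z e, Fbar (z, e) = (F z, -⟪gradE z, F z⟫))
    (dSbar dEbar : EuclideanSpace ℝ (Fin n) × ℝ →
      EuclideanSpace ℝ (Fin n) × ℝ)
    (hdSbar : ∀ z e, dSbar (z, e) = (gradS z - gradE z, (-1 : ℝ)))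
    (hdEbar : ∀ z e, dEbar (z, e) = (gradE z, (1 : ℝ)))
    (Psibar : EuclideanSpace ℝ (Fin n) × ℝ →
      EuclideanSpace ℝ (Fin n) × ℝ → EReal)
    (hPsibar : ∀ p q : EuclideanSpace ℝ (Fin n) × ℝ,
      Psibar p q = ⨆ w : EuclideanSpace ℝ (Fin n) × ℝ,
        ((⟪q.1, w.1⟫ + q.2 * w.2 - Psibarstar p w : ℝ) : EReal)) :
    -- (i) L̄ is antisymmetric
    (∀ (p q₁ q₂ : EuclideanSpace ℝ (Fin n) × ℝ),
      ⟪q₁.1, (Lbar p q₂).1⟫ + q₁.2 * (Lbar p q₂).2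
        = -(⟪q₂.1, (Lbar p q₁).1⟫ + q₂.2 * (Lbar p q₁).2)) ∧
    -- (ii) L̄ dS̄ = 0
    (∀ (z : EuclideanSpace ℝ (Fin n)) (e : ℝ),
      Lbar (z, e) (dSbar (z, e)) = 0) ∧
    -- (iii) Ψ̄* is invariant in the direction dĒ
    (∀ (z : EuclideanSpace ℝ (Fin n)) (e : ℝ)
      (q : EuclideanSpace ℝ (Fin n) × ℝ) (α : ℝ),
      Psibarstar (z, e) (q + α • dEbar (z, e)) = Psibarstar (z, e) q) ∧
    -- (iv) the GENERIC equation for F̄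
    (∀ (z : EuclideanSpace ℝ (Fin n)) (e : ℝ),
      Psibar (z, e) (Fbar (z, e) - Lbar (z, e) (dEbar (z, e)))
        + ((Psibarstar (z, e) (-(2⁻¹ : ℝ) • dSbar (z, e)) : ℝ) : EReal)
        + (((2⁻¹ : ℝ) * (⟪(Fbar (z, e)).1, (dSbar (z, e)).1⟫
            + (Fbar (z, e)).2 * (dSbar (z, e)).2) : ℝ) : EReal)
        = (0 : EReal)) := by
  refine ⟨?_, ?_, ?_, ?_⟩
  · rintro ⟨z, e⟩ ⟨ξ, r⟩ ⟨η, s⟩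
    simp only [hLbar, mul_zero, add_zero]
    rw [real_inner_comm, hLanti, real_inner_comm]
  · intro z e
    simp [hdSbar, hLbar, hLSE]
  · rintro z e ⟨ξ, r⟩ α
    simp only [hdEbar, Prod.smul_mk, Prod.mk_add_mk, hPsibarstar, smul_eq_mul, mul_one]
    congr 1
    module
  · intro z e
    have hWE : ⟪gradE z, W z⟫ = 0 := by
      have h := hLanti z (gradE z) (gradE z)
      rw [hW, real_inner_comm]
      linarith
    have hΨbar : Psibar (z, e) (F z - W z, -⟪gradE z, F z⟫) = Ψ z (F z - W z) := by
      rw [hPsibar]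
      simp only [hPsibarstar]
      exact iSup_inner_add_mul_sub_comp_sub_smul (φ := Ψstar z) (g := gradE z)
        (v := (F z - W z, -⟪gradE z, F z⟫)) (by simp [inner_sub_right, hWE]) (hΨ z _)
    have hdual : -(2⁻¹ : ℝ) • (gradS z - gradE z) - (-(2⁻¹ : ℝ) * -1) • gradE z
        = -(2⁻¹ : ℝ) • gradS z := by
      module
    have hpair : ⟪F z, gradS z - gradE z⟫ + -⟪gradE z, F z⟫ * -1 = ⟪F z, gradS z⟫ := by
      rw [inner_sub_right, real_inner_comm (F z) (gradE z)]
      ring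
    rw [hFbar, hdEbar, hLbar, hdSbar, ← hW, Prod.mk_sub_mk, sub_zero, hΨbar, Prod.smul_mk,
      hPsibarstar, smul_eq_mul, hdual, hpair]
    exact_mod_cast hpre z
end

section
/- Let S, E : ℝⁿ → ℝ be differentiable with gradients ∇S, ∇E, let L(z) : ℝⁿ → ℝⁿ be a family of linear maps with ⟨L(z)ξ, η⟩ = −⟨L(z)η, ξ⟩ and L(z)(∇S(z) − ∇E(z)) = 0 for all z, ξ, η, and set W(z) := L(z)∇E(z). Let Ψ* : ℝⁿ × ℝⁿ → ℝ be symmetric with second-variable Legendre transform Ψ, assumed finite, and let F : ℝⁿ → ℝⁿ satisfy Ψ(z, F(z) − W(z)) + Ψ*(z, −½∇S(z)) + ½⟨F(z), ∇S(z)⟩ = 0 for all z. For α ∈ [0,1] define on ℝⁿ × ℝ: E_α(z,e) := e + E(z), S_α(z,e) := S(z) − α(e + E(z)), Ψ*_α((z,e),(ξ,r)) := Ψ*(z, ξ − r·∇E(z)), L_α(z,e)(ξ,r) := (αL(z)ξ + (1−α)r·W(z), −(1−α)⟨W(z), ξ⟩), F̄(z,e) := (F(z), −⟨∇E(z), F(z)⟩),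 and let Ψ_α be the Legendre transform of Ψ*_α((z,e), ·) over ℝⁿ × ℝ (values in ℝ ∪ {+∞}). Then for every α ∈ [0,1]: (i) L_α is antisymmetric; (ii) L_α(z,e) dS_α(z,e) = 0, where dS_α(z,e) = (∇S(z) − α∇E(z), −α); (iii) Ψ*_α((z,e), (ξ,r) + β dE_α(z,e)) = Ψ*_α((z,e),(ξ,r)) for all β ∈ ℝ, where dE_α(z,e) = (∇E(z), 1); (iv) the GENERIC equation holds: Ψ_α((z,e), F̄(z,e) − L_α(z,e) dE_α(z,e)) + Ψ*_α((z,e), −½ dS_α(z,e)) + ½⟨F̄(z,e), dS_α(z,e)⟩ = 0. -/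
open scoped RealInnerProductSpace

/-- The Remark following Theorem 4.2: a one-parameter family of GENERIC structures,
for `α ∈ [0,1]`, interpolating between the trivial and the natural extension of a
pre-GENERIC system to GENERIC. -/
theorem preGENERIC_to_GENERIC_interpolating_family (n : ℕ)
    (S E : EuclideanSpace ℝ (Fin n) → ℝ)
    (gradS gradE : EuclideanSpace ℝ (Fin n) → EuclideanSpace ℝ (Fin n))
    (hS : ∀ z, HasGradientAt S (gradS z) z)
    (hE : ∀ z, HasGradientAt E (gradE z) z)
    (L : EuclideanSpace ℝ (Fin n) →
      EuclideanSpace ℝ (Fin n) →ₗ[ℝ] EuclideanSpace ℝ (Fin n))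
    (hLanti : ∀ z ξ η, ⟪L z ξ, η⟫ = -⟪L z η, ξ⟫)
    (hLSE : ∀ z, L z (gradS z - gradE z) = 0)
    (W : EuclideanSpace ℝ (Fin n) → EuclideanSpace ℝ (Fin n))
    (hW : ∀ z, W z = L z (gradE z))
    (Ψstar : EuclideanSpace ℝ (Fin n) → EuclideanSpace ℝ (Fin n) → ℝ)
    (hΨstarSym : ∀ z ξ, Ψstar z ξ = Ψstar z (-ξ))
    (Ψ : EuclideanSpace ℝ (Fin n) → EuclideanSpace ℝ (Fin n) → ℝ)
    (hΨ : ∀ z v, IsLUB {y : ℝ | ∃ ξ, y = ⟪v, ξ⟫ - Ψstar z ξ} (Ψ z v))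
    (F : EuclideanSpace ℝ (Fin n) → EuclideanSpace ℝ (Fin n))
    (hpre : ∀ z, Ψ z (F z - W z) + Ψstar z (-(2⁻¹ : ℝ) • gradS z)
      + (2⁻¹ : ℝ) * ⟪F z, gradS z⟫ = 0)
    -- the interpolating extended objects on ℝⁿ × ℝ
    (Ealpha Salpha : ℝ → EuclideanSpace ℝ (Fin n) × ℝ → ℝ)
    (hEalpha : ∀ (α : ℝ) (z : EuclideanSpace ℝ (Fin n)) (e : ℝ),
      Ealpha α (z, e) = e + E z)
    (hSalpha : ∀ (α : ℝ) (z : EuclideanSpace ℝ (Fin n)) (e : ℝ),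
      Salpha α (z, e) = S z - α * (e + E z))
    (Psistaralpha : ℝ → EuclideanSpace ℝ (Fin n) × ℝ →
      EuclideanSpace ℝ (Fin n) × ℝ → ℝ)
    (hPsistaralpha : ∀ (α : ℝ) (z : EuclideanSpace ℝ (Fin n)) (e : ℝ)
      (ξ : EuclideanSpace ℝ (Fin n)) (r : ℝ),
      Psistaralpha α (z, e) (ξ, r) = Ψstar z (ξ - r • gradE z))
    (Lalpha : ℝ → EuclideanSpace ℝ (Fin n) × ℝ →
      EuclideanSpace ℝ (Fin n) × ℝ → EuclideanSpace ℝ (Fin n) × ℝ)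
    (hLalpha : ∀ (α : ℝ) (z : EuclideanSpace ℝ (Fin n)) (e : ℝ)
      (ξ : EuclideanSpace ℝ (Fin n)) (r : ℝ),
      Lalpha α (z, e) (ξ, r)
        = (α • L z ξ + ((1 - α) * r) • W z, -((1 - α) * ⟪W z, ξ⟫)))
    (Fbar : EuclideanSpace ℝ (Fin n) × ℝ → EuclideanSpace ℝ (Fin n) × ℝ)
    (hFbar : ∀ z e, Fbar (z, e) = (F z, -⟪gradE z, F z⟫))
    (dSalpha dEalpha : ℝ → EuclideanSpace ℝ (Fin n) × ℝ →
      EuclideanSpace ℝ (Fin n) × ℝ)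
    (hdSalpha : ∀ (α : ℝ) (z : EuclideanSpace ℝ (Fin n)) (e : ℝ),
      dSalpha α (z, e) = (gradS z - α • gradE z, -α))
    (hdEalpha : ∀ (α : ℝ) (z : EuclideanSpace ℝ (Fin n)) (e : ℝ),
      dEalpha α (z, e) = (gradE z, (1 : ℝ)))
    (Psialpha : ℝ → EuclideanSpace ℝ (Fin n) × ℝ →
      EuclideanSpace ℝ (Fin n) × ℝ → EReal)
    (hPsialpha : ∀ (α : ℝ) (p q : EuclideanSpace ℝ (Fin n) × ℝ),
      Psialpha α p q = ⨆ w : EuclideanSpace ℝ (Fin n) × ℝ,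
        ((⟪q.1, w.1⟫ + q.2 * w.2 - Psistaralpha α p w : ℝ) : EReal)) :
    ∀ α ∈ Set.Icc (0 : ℝ) 1,
      -- (i) L_α is antisymmetric
      (∀ (p q₁ q₂ : EuclideanSpace ℝ (Fin n) × ℝ),
        ⟪q₁.1, (Lalpha α p q₂).1⟫ + q₁.2 * (Lalpha α p q₂).2
          = -(⟪q₂.1, (Lalpha α p q₁).1⟫ + q₂.2 * (Lalpha α p q₁).2)) ∧
      -- (ii) L_α dS_α = 0
      (∀ (z : EuclideanSpace ℝ (Fin n)) (e : ℝ),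
        Lalpha α (z, e) (dSalpha α (z, e)) = 0) ∧
      -- (iii) Ψ*_α is invariant in the direction dE_α
      (∀ (z : EuclideanSpace ℝ (Fin n)) (e : ℝ)
        (q : EuclideanSpace ℝ (Fin n) × ℝ) (β : ℝ),
        Psistaralpha α (z, e) (q + β • dEalpha α (z, e))
          = Psistaralpha α (z, e) q) ∧
      -- (iv) the GENERIC equation for F̄
      (∀ (z : EuclideanSpace ℝ (Fin n)) (e : ℝ),
        Psialpha α (z, e) (Fbar (z, e) - Lalpha α (z, e) (dEalpha α (z, e)))
          + ((Psistaralpha α (z, e) (-(2⁻¹ : ℝ) • dSalpha α (z, e)) : ℝ) : EReal)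
          + (((2⁻¹ : ℝ) * (⟪(Fbar (z, e)).1, (dSalpha α (z, e)).1⟫
              + (Fbar (z, e)).2 * (dSalpha α (z, e)).2) : ℝ) : EReal)
          = (0 : EReal)) := by
  have hWS : ∀ z, L z (gradS z) = W z := fun z => by
    rw [hW]
    exact sub_eq_zero.mp (by rw [← map_sub, hLSE])
  have hanti : ∀ z ξ, ⟪L z ξ, ξ⟫ = 0 := fun z ξ => by linarith [hLanti z ξ ξ]
  have hWgradE : ∀ z, ⟪W z, gradE z⟫ = 0 := fun z => by rw [hW, hanti]
  have hWgradS : ∀ z, ⟪W z, gradS z⟫ = 0 := fun z => by rw [← hWS, hanti]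
  rintro α -
  refine ⟨?_, ?_, ?_, ?_⟩
  · rintro ⟨z, e⟩ ⟨ξ, r⟩ ⟨η, s⟩
    have h := hLanti z ξ η
    simp only [hLalpha, inner_add_right, real_inner_smul_right]
    rw [real_inner_comm (W z) ξ, real_inner_comm (W z) η, real_inner_comm (L z η) ξ,
      real_inner_comm (L z ξ) η, h]
    ring
  · intro z e
    rw [hdSalpha, hLalpha, map_sub, map_smul, hWS, ← hW, inner_sub_right,
      real_inner_smul_right, hWgradS, hWgradE]
    refine Prod.ext ?_ ?_
    · simp only [Prod.fst_zero]
      module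
    · simp
  · rintro z e ⟨ξ, r⟩ β
    rw [hdEalpha, Prod.smul_mk, Prod.mk_add_mk, hPsistaralpha, hPsistaralpha]
    congr 1
    simp only [smul_eq_mul]
    module
  · intro z e
    have hLdE : Lalpha α (z, e) (dEalpha α (z, e)) = (W z, 0) := by
      rw [hdEalpha, hLalpha, ← hW, hWgradE]
      refine Prod.ext ?_ ?_
      · dsimp only
        module
      · simp
    have hstar : Psistaralpha α (z, e) (-(2⁻¹ : ℝ) • dSalpha α (z, e))
        = Ψstar z (-(2⁻¹ : ℝ) • gradS z) := by
      rw [hdSalpha, Prod.smul_mk, hPsistaralpha]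
      congr 1
      simp only [smul_eq_mul]
      module
    have hinner : ⟪F z, gradS z - α • gradE z⟫ + -⟪gradE z, F z⟫ * -α
        = ⟪F z, gradS z⟫ := by
      rw [inner_sub_right, real_inner_smul_right, real_inner_comm (gradE z)]
      ring
    have hval : ∀ ξ r, ⟪F z - W z, ξ⟫ + -⟪gradE z, F z⟫ * r
        = ⟪F z - W z, ξ - r • gradE z⟫ := fun ξ r => by
      rw [inner_sub_right _ ξ, real_inner_smul_right, inner_sub_left _ _ (gradE z), hWgradE,
        real_inner_comm (gradE z)]
      ring
    have hPsi : Psialpha α (z, e) (F z - W z, -⟪gradE z, F z⟫)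
        = ((Ψ z (F z - W z) : ℝ) : EReal) := by
      rw [hPsialpha]
      refine le_antisymm (iSup_le ?_) (EReal.le_of_forall_lt_iff_le.mp ?_)
      · rintro ⟨ξ, r⟩
        rw [hPsistaralpha, hval]
        exact EReal.coe_le_coe_iff.mpr ((hΨ z _).1 ⟨_, rfl⟩)
      · intro c hc
        refine EReal.coe_le_coe_iff.mpr ((hΨ z _).2 ?_)
        rintro _ ⟨ξ, rfl⟩
        have h := (le_iSup (fun w : EuclideanSpace ℝ (Fin n) × ℝ =>
          ((⟪F z - W z, w.1⟫ + -⟪gradE z, F z⟫ * w.2 - Psistaralpha α (z, e) w : ℝ) : EReal))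
          (ξ, 0)).trans hc.le
        simpa [hPsistaralpha] using EReal.coe_le_coe_iff.mp h
    rw [hstar, hLdE, hFbar, hdSalpha, Prod.mk_sub_mk, sub_zero, hPsi, hinner,
      ← EReal.coe_add, ← EReal.coe_add, hpre, EReal.coe_zero]
end
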